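/- Let a : ℕ → ℝ with a(j) > 0 for all j ≥ 1 and Σ_{j≥1} 1/a(j) = ∞, and b : ℕ → ℝ, be Jacobi parameters, and let (m_j) and (l_j) be arbitrary sequences of natural numbers. Define A₁ = {E ∈ ℝ : liminf_{j→∞} (1/a(l_j))·‖T_{m_j}(E)·T_{l_j}(E)^{-1}‖ < ∞}. Let μ be a finite Borel measure on ℝ for which the polynomials {E ↦ u_{1,E}(j)}_{j≥1} form an orthonormal system in L²(μ). Then the absolutely continuous part of μ in its Lebesgue decomposition with respect to Lebesgue measure gives zero mass to ℝ ∖ A₁; equivalently, the restriction of μ to ℝ ∖ A₁ is singular with respect to Lebesgue measure. -/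

import Mathlib

open MeasureTheory Filter

/-- `u1sol a b E` is the solution `u_{1,E}` of the eigenvalue equation with
`u(0) = 0`, `u(1) = 1`. -/
noncomputable def u1sol (a b : ℕ → ℝ) (E : ℝ) : ℕ → ℝ
  | 0 => 0
  | 1 => 1
  | (j + 2) => ((E - b (j + 1)) * u1sol a b E (j + 1) - a j * u1sol a b E j) / a (j + 1)

/-- The one-step transfer matrix `S_j(E)`. -/
noncomputable def Smat (a b : ℕ → ℝ) (E : ℝ) (j : ℕ) : Matrix (Fin 2) (Fin 2) ℝ :=
  !![(E - b j) / a j, -(a (j - 1)) / a j; 1, 0]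

/-- The transfer matrix `T_j(E) = S_j(E) ⋯ S_1(E)` (with `T_0(E) = 1`). -/
noncomputable def Tmat (a b : ℕ → ℝ) (E : ℝ) : ℕ → Matrix (Fin 2) (Fin 2) ℝ
  | 0 => 1
  | (j + 1) => Smat a b E (j + 1) * Tmat a b E j

/-- The operator norm of a real 2×2 matrix. -/
noncomputable def matOpNorm (M : Matrix (Fin 2) (Fin 2) ℝ) : ℝ :=
  ‖Matrix.toEuclideanCLM (𝕜 := ℝ) M‖

/-- The Stieltjes transform `z ↦ ∫ h(x) / (x - z) dμ(x)` of the measure `h μ`. -/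
noncomputable def stieltjes (μ : Measure ℝ) (h : ℝ → ℝ) (z : ℂ) : ℂ :=
  ∫ x, (h x : ℂ) / ((x : ℂ) - z) ∂μ

section Stieltjes

variable {μ : Measure ℝ} {h : ℝ → ℝ} {z : ℂ}

lemma im_le_norm_ofReal_sub (x : ℝ) (z : ℂ) : z.im ≤ ‖(x : ℂ) - z‖ := by
  have := Complex.abs_im_le_norm ((x : ℂ) - z)
  simp only [Complex.sub_im, Complex.ofReal_im, zero_sub, abs_neg] at this
  exact (le_abs_self _).trans this

lemma ofReal_sub_ne_zero (x : ℝ) (hz : 0 < z.im) : (x : ℂ) - z ≠ 0 :=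
  norm_pos_iff.1 (hz.trans_le (im_le_norm_ofReal_sub x z))

lemma aestronglyMeasurable_stieltjes_kernel (hh : Integrable h μ) (z : ℂ) :
    AEStronglyMeasurable (fun x : ℝ => (h x : ℂ) / ((x : ℂ) - z)) μ := by
  have h1 : AEMeasurable (fun x : ℝ => (h x : ℂ)) μ :=
    Complex.measurable_ofReal.comp_aemeasurable hh.aemeasurable
  have h2 : Measurable fun x : ℝ => (x : ℂ) - z := by fun_prop
  exact (h1.div h2.aemeasurable).aestronglyMeasurable

lemma norm_stieltjes_kernel_le (h : ℝ → ℝ) (hz : 0 < z.im) (x : ℝ) :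
    ‖(h x : ℂ) / ((x : ℂ) - z)‖ ≤ ‖h x‖ / z.im := by
  rw [norm_div, Complex.norm_real]
  gcongr
  exact im_le_norm_ofReal_sub x z

lemma integrable_stieltjes_kernel (hh : Integrable h μ) (hz : 0 < z.im) :
    Integrable (fun x : ℝ => (h x : ℂ) / ((x : ℂ) - z)) μ :=
  (hh.norm.div_const z.im).mono' (aestronglyMeasurable_stieltjes_kernel hh z)
    (ae_of_all _ (norm_stieltjes_kernel_le h hz))

lemma norm_stieltjes_le (hh : Integrable h μ) (hz : 0 < z.im) :
    ‖stieltjes μ h z‖ ≤ (∫ x, ‖h x‖ ∂μ) / z.im := by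
  rw [← integral_div]
  exact norm_integral_le_of_norm_le (hh.norm.div_const z.im)
    (ae_of_all _ (norm_stieltjes_kernel_le h hz))

lemma stieltjes_im_nonneg (hh : Integrable h μ) (h0 : ∀ x, 0 ≤ h x) (hz : 0 < z.im) :
    0 ≤ (stieltjes μ h z).im := by
  have := Complex.imCLM.integral_comp_comm (integrable_stieltjes_kernel hh hz)
  simp only [Complex.imCLM_apply] at this
  rw [stieltjes, ← this]
  refine integral_nonneg fun x => ?_
  rw [Pi.zero_apply, div_eq_mul_inv, Complex.im_ofReal_mul, Complex.inv_im]
  refine mul_nonneg (h0 x) (div_nonneg ?_ (Complex.normSq_nonneg _))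
  simp [hz.le]

lemma differentiableAt_stieltjes (hh : Integrable h μ) (hz : 0 < z.im) :
    DifferentiableAt ℂ (stieltjes μ h) z := by
  have hs : {w : ℂ | z.im / 2 < w.im} ∈ nhds z :=
    (isOpen_lt continuous_const Complex.continuous_im).mem_nhds (by simpa using hz)
  refine (hasDerivAt_integral_of_dominated_loc_of_deriv_le
    (F' := fun w x => (h x : ℂ) / ((x : ℂ) - w) ^ 2) (bound := fun x => ‖h x‖ / (z.im / 2) ^ 2)
    hs (Eventually.of_forall fun w => aestronglyMeasurable_stieltjes_kernel hh w)
    (integrable_stieltjes_kernel hh hz) ?_ (ae_of_all _ fun x w hw => ?_)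
    (hh.norm.div_const _) (ae_of_all _ fun x w hw => ?_)).2.differentiableAt
  · have h1 : AEMeasurable (fun x : ℝ => (h x : ℂ)) μ :=
      Complex.measurable_ofReal.comp_aemeasurable hh.aemeasurable
    have h2 : Measurable fun x : ℝ => ((x : ℂ) - z) ^ 2 := by fun_prop
    exact (h1.div h2.aemeasurable).aestronglyMeasurable
  · have hw' : z.im / 2 < w.im := hw
    rw [norm_div, Complex.norm_real, norm_pow]
    gcongr
    exact hw'.le.trans (im_le_norm_ofReal_sub x w)
  · have hw' : 0 < w.im := (half_pos hz).trans hw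
    have hne := ofReal_sub_ne_zero x hw'
    have h1 : HasDerivAt (fun w : ℂ => (x : ℂ) - w) (-1) w := (hasDerivAt_id w).const_sub _
    refine ((hasDerivAt_const w (h x : ℂ)).div h1 hne).congr_deriv ?_
    ring

end Stieltjes

/-- The Cayley transform from the unit disc to the upper half-plane. -/
noncomputable def cayley (ζ : ℂ) : ℂ := Complex.I * ((1 + ζ) / (1 - ζ))

lemma cayley_zero : cayley 0 = Complex.I := by simp [cayley]

lemma one_sub_ne_zero_of_norm_lt {ζ : ℂ} (hζ : ‖ζ‖ < 1) : 1 - ζ ≠ 0 := by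
  rw [sub_ne_zero]
  rintro rfl
  simp at hζ

lemma cayley_im_pos {ζ : ℂ} (hζ : ‖ζ‖ < 1) : 0 < (cayley ζ).im := by
  have h1 : 0 < Complex.normSq (1 - ζ) :=
    Complex.normSq_pos.2 (one_sub_ne_zero_of_norm_lt hζ)
  have h2 : Complex.normSq ζ < 1 := by
    rw [Complex.normSq_eq_norm_sq]
    nlinarith [norm_nonneg ζ]
  have h3 : (cayley ζ).im = (1 - Complex.normSq ζ) / Complex.normSq (1 - ζ) := by
    simp only [cayley, Complex.I_mul_im, Complex.div_re, Complex.normSq_apply]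
    simp
    ring
  rw [h3]
  exact div_pos (by linarith) h1

lemma differentiableAt_cayley {ζ : ℂ} (hζ : 1 - ζ ≠ 0) : DifferentiableAt ℂ cayley ζ := by
  unfold cayley
  fun_prop (disch := exact hζ)

/-- The point of the upper half-plane corresponding to `r e^{iθ}` in the unit disc. -/
noncomputable def discPoint (r θ : ℝ) : ℂ := cayley (circleMap 0 r θ)

lemma discPoint_im_pos {r : ℝ} (h0 : 0 ≤ r) (h1 : r < 1) (θ : ℝ) : 0 < (discPoint r θ).im :=
  cayley_im_pos (by simpa [abs_of_nonneg h0] using h1)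

/-- Lebesgue measure on the circle, parametrized by the angle. -/
noncomputable def angleMeasure : Measure ℝ := volume.restrict (Set.Ioo 0 (2 * Real.pi))

instance : IsFiniteMeasure angleMeasure := by
  unfold angleMeasure
  infer_instance

/-- The real number corresponding to the boundary point `e^{iθ}` of the unit disc. -/
noncomputable def boundaryPoint (θ : ℝ) : ℝ := Real.tan ((θ - Real.pi) / 2)

lemma integral_angleMeasure_of_differentiableAt {G : ℂ → ℂ}
    (hG : ∀ z : ℂ, 0 < z.im → DifferentiableAt ℂ G z) {r : ℝ} (h0 : 0 ≤ r) (h1 : r < 1) :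
    ∫ θ, G (discPoint r θ) ∂angleMeasure = (2 * Real.pi : ℝ) • G Complex.I := by
  have hd : ∀ ζ ∈ Metric.closedBall (0 : ℂ) |r|, DifferentiableAt ℂ (fun ζ => G (cayley ζ)) ζ := by
    intro ζ hζ
    have hζ' : ‖ζ‖ < 1 := by
      rw [mem_closedBall_zero_iff, abs_of_nonneg h0] at hζ
      exact hζ.trans_lt h1
    exact (hG _ (cayley_im_pos hζ')).comp ζ
      (differentiableAt_cayley (one_sub_ne_zero_of_norm_lt hζ'))
  have := circleAverage_of_differentiable_on_off_countable (Set.countable_empty)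
    (fun ζ hζ => (hd ζ hζ).continuousAt.continuousWithinAt)
    (fun ζ hζ => hd ζ (Metric.ball_subset_closedBall hζ.1))
  rw [Real.circleAverage_def, inv_smul_eq_iff₀ (by positivity), cayley_zero,
    intervalIntegral.integral_of_le (by positivity), integral_Ioc_eq_integral_Ioo] at this
  exact this

lemma continuous_discPoint {r : ℝ} (h0 : 0 ≤ r) (h1 : r < 1) : Continuous (discPoint r) := by
  refine continuous_iff_continuousAt.2 fun θ => ?_
  have hζ : ‖circleMap 0 r θ‖ < 1 := by simpa [abs_of_nonneg h0] using h1
  exact (differentiableAt_cayley (one_sub_ne_zero_of_norm_lt hζ)).continuousAt.comp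
    (continuous_circleMap 0 r).continuousAt

/-- For `w` in the upper half-plane, `1 - 1 / (1 - i w) = -i w / (1 - i w)` has nonnegative real
part, bounded below where `‖w‖ ≥ 1`. -/
lemma one_sub_inv_re_bounds {w : ℂ} (hw : 0 ≤ w.im) :
    0 ≤ (1 - (1 - Complex.I * w)⁻¹).re ∧
      (1 ≤ ‖w‖ → 1 / 4 ≤ (1 - (1 - Complex.I * w)⁻¹).re) ∧
      (1 - (1 - Complex.I * w)⁻¹).re ≤ ‖w‖ ∧ 1 - Complex.I * w ≠ 0 := by
  have hre : 1 ≤ (1 - Complex.I * w).re := by simp [hw]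
  have hnorm : 1 ≤ ‖1 - Complex.I * w‖ := hre.trans (Complex.re_le_norm _)
  have hne : 1 - Complex.I * w ≠ 0 := norm_pos_iff.1 (by linarith)
  have hsq : 0 < 1 + 2 * w.im + (w.re ^ 2 + w.im ^ 2) := by positivity
  have heq : (1 - (1 - Complex.I * w)⁻¹).re =
      (w.im + (w.re ^ 2 + w.im ^ 2)) / (1 + 2 * w.im + (w.re ^ 2 + w.im ^ 2)) := by
    have h2 : Complex.normSq (1 - Complex.I * w) = 1 + 2 * w.im + (w.re ^ 2 + w.im ^ 2) := by
      simp [Complex.normSq_apply]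
      ring
    rw [Complex.sub_re, Complex.inv_re, h2, eq_div_iff hsq.ne', sub_mul, div_mul_cancel₀ _ hsq.ne']
    simp
    ring
  refine ⟨?_, fun h => ?_, ?_, hne⟩
  · rw [heq]
    positivity
  · have h3 : 1 ≤ w.re ^ 2 + w.im ^ 2 := by
      have h4 := Complex.sq_norm w
      rw [Complex.normSq_apply] at h4
      nlinarith
    rw [heq, div_le_div_iff₀ (by norm_num) hsq]
    linarith
  · refine (Complex.re_le_norm _).trans ?_
    have : 1 - (1 - Complex.I * w)⁻¹ = -(Complex.I * w) / (1 - Complex.I * w) := by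
      field_simp
      ring
    rw [this, norm_div, norm_neg, norm_mul, Complex.norm_I, one_mul]
    exact div_le_self (norm_nonneg _) hnorm

/-- Weak-type `L¹` bound for Stieltjes transforms of nonnegative densities along the circles
`discPoint r`, uniform in `r`. -/
lemma angleMeasure_stieltjes_ge_le {μ : Measure ℝ} {h : ℝ → ℝ} (hh : Integrable h μ)
    (h0 : ∀ x, 0 ≤ h x) {r : ℝ} (hr0 : 0 ≤ r) (hr1 : r < 1) {c : ℝ} (hc : 0 < c) :
    angleMeasure {θ | c ≤ ‖stieltjes μ h (discPoint r θ)‖} ≤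
      ENNReal.ofReal (8 * Real.pi * (∫ x, h x ∂μ) / c) := by
  set W : ℂ → ℂ := fun z => (c⁻¹ : ℝ) * stieltjes μ h z with hW
  have hWim : ∀ z : ℂ, 0 < z.im → 0 ≤ (W z).im := fun z hz => by
    rw [hW, Complex.im_ofReal_mul]
    exact mul_nonneg (inv_nonneg.2 hc.le) (stieltjes_im_nonneg hh h0 hz)
  set G : ℂ → ℂ := fun z => 1 - (1 - Complex.I * W z)⁻¹ with hG
  have hGd : ∀ z : ℂ, 0 < z.im → DifferentiableAt ℂ G z := fun z hz => by
    have h1 : DifferentiableAt ℂ W z := (differentiableAt_stieltjes hh hz).const_mul _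
    have h2 := (one_sub_inv_re_bounds (hWim z hz)).2.2.2
    exact (((h1.const_mul Complex.I).const_sub 1).inv h2).const_sub 1
  have hGc : Continuous fun θ => G (discPoint r θ) := continuous_iff_continuousAt.2 fun θ =>
    (hGd _ (discPoint_im_pos hr0 hr1 θ)).continuousAt.comp
      (continuous_discPoint hr0 hr1).continuousAt
  have hGi : Integrable (fun θ => G (discPoint r θ)) angleMeasure :=
    (hGc.integrableOn_Icc (a := 0) (b := 2 * Real.pi)).mono_set Set.Ioo_subset_Icc_self
  have hmv := integral_angleMeasure_of_differentiableAt hGd hr0 hr1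
  have hre := Complex.reCLM.integral_comp_comm hGi
  simp only [Complex.reCLM_apply] at hre
  rw [hmv, Complex.smul_re, smul_eq_mul] at hre
  have hI : (G Complex.I).re ≤ (∫ x, h x ∂μ) / c := by
    refine (one_sub_inv_re_bounds (hWim Complex.I (by simp))).2.2.1.trans ?_
    have h2 := norm_stieltjes_le hh (z := Complex.I) (by simp)
    simp only [Complex.I_im, div_one, Real.norm_of_nonneg (h0 _)] at h2
    rw [hW, norm_mul, Complex.norm_real, Real.norm_of_nonneg (inv_nonneg.2 hc.le),
      inv_mul_eq_div]
    gcongr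
  have hmk := mul_meas_ge_le_integral_of_nonneg (μ := angleMeasure)
    (f := fun θ => (G (discPoint r θ)).re)
    (ae_of_all _ fun θ => (one_sub_inv_re_bounds (hWim _ (discPoint_im_pos hr0 hr1 θ))).1)
    hGi.re (1 / 4)
  rw [hre] at hmk
  have hsub : {θ | c ≤ ‖stieltjes μ h (discPoint r θ)‖} ⊆
      {θ | 1 / 4 ≤ (G (discPoint r θ)).re} := fun θ hθ => by
    refine (one_sub_inv_re_bounds (hWim _ (discPoint_im_pos hr0 hr1 θ))).2.1 ?_
    rw [hW, norm_mul, Complex.norm_real, Real.norm_of_nonneg (inv_nonneg.2 hc.le),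
      inv_mul_eq_div, one_le_div hc]
    exact hθ
  refine (measure_mono hsub).trans ?_
  rw [← ofReal_measureReal]
  refine ENNReal.ofReal_le_ofReal ?_
  have : 2 * Real.pi * (G Complex.I).re ≤ 2 * Real.pi * ((∫ x, h x ∂μ) / c) := by gcongr
  rw [mul_div_assoc]
  linarith

lemma stieltjes_sub {μ : Measure ℝ} {g h : ℝ → ℝ} (hg : Integrable g μ) (hh : Integrable h μ)
    {z : ℂ} (hz : 0 < z.im) :
    stieltjes μ (fun x => g x - h x) z = stieltjes μ g z - stieltjes μ h z := by
  unfold stieltjes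
  rw [← integral_sub (integrable_stieltjes_kernel hg hz) (integrable_stieltjes_kernel hh hz)]
  simp only [Complex.ofReal_sub, sub_div]

/-- Weak-type `L¹` bound for Stieltjes transforms of signed densities. -/
lemma angleMeasure_stieltjes_signed_ge_le {μ : Measure ℝ} {h : ℝ → ℝ} (hh : Integrable h μ)
    {r : ℝ} (hr0 : 0 ≤ r) (hr1 : r < 1) {c : ℝ} (hc : 0 < c) :
    angleMeasure {θ | c ≤ ‖stieltjes μ h (discPoint r θ)‖} ≤
      ENNReal.ofReal (16 * Real.pi * (∫ x, |h x| ∂μ) / c) := by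
  have hp := angleMeasure_stieltjes_ge_le hh.pos_part (fun x => le_max_right _ _) hr0 hr1
    (half_pos hc)
  have hn := angleMeasure_stieltjes_ge_le hh.neg_part (fun x => le_max_right _ _) hr0 hr1
    (half_pos hc)
  have hsplit : ∀ x, h x = max (h x) 0 - max (-h x) 0 := fun x => by
    rcases le_total 0 (h x) with h1 | h1 <;> simp [h1]
  have habs : ∀ x, |h x| = max (h x) 0 + max (-h x) 0 := fun x => by
    rcases le_total 0 (h x) with h1 | h1 <;> simp [h1, abs_of_nonneg, abs_of_nonpos]
  have hint : ∫ x, |h x| ∂μ = ∫ x, max (h x) 0 ∂μ + ∫ x, max (-h x) 0 ∂μ := by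
    rw [← integral_add hh.pos_part hh.neg_part]
    exact integral_congr_ae (ae_of_all _ habs)
  have hp0 : 0 ≤ ∫ x, max (h x) 0 ∂μ := integral_nonneg fun x => le_max_right _ _
  have hn0 : 0 ≤ ∫ x, max (-h x) 0 ∂μ := integral_nonneg fun x => le_max_right _ _
  have hsub : {θ | c ≤ ‖stieltjes μ h (discPoint r θ)‖} ⊆
      {θ | c / 2 ≤ ‖stieltjes μ (fun x => max (h x) 0) (discPoint r θ)‖} ∪
      {θ | c / 2 ≤ ‖stieltjes μ (fun x => max (-h x) 0) (discPoint r θ)‖} := fun θ hθ => by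
    have h1 := stieltjes_sub hh.pos_part hh.neg_part (discPoint_im_pos hr0 hr1 θ)
    simp only [← hsplit] at h1
    have h2 : c ≤ ‖stieltjes μ h (discPoint r θ)‖ := hθ
    have h3 : ‖stieltjes μ h (discPoint r θ)‖ ≤ _ := (congrArg norm h1).le.trans (norm_sub_le _ _)
    by_contra hcon
    simp only [Set.mem_union, Set.mem_ofPred_eq, not_or, not_le] at hcon
    linarith [hcon.1, hcon.2]
  refine (measure_mono hsub).trans ((measure_union_le _ _).trans ((add_le_add hp hn).trans ?_))
  rw [← ENNReal.ofReal_add (by positivity) (by positivity), hint]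
  refine ENNReal.ofReal_le_ofReal (le_of_eq ?_)
  field_simp
  ring

lemma measure_eventually_mem_le {α : Type*} [MeasurableSpace α] {μ : Measure α} {s : ℕ → Set α}
    {C : ENNReal} (h : ∀ n, μ (s n) ≤ C) : μ {x | ∀ᶠ n in atTop, x ∈ s n} ≤ C := by
  have heq : {x | ∀ᶠ n in atTop, x ∈ s n} = ⋃ N, ⋂ n ≥ N, s n := by
    ext x
    simp [eventually_atTop]
  have hmono : Monotone fun N => ⋂ n ≥ N, s n := fun N N' hN =>
    Set.biInter_subset_biInter_left fun n hn => le_trans hN hn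
  rw [heq, hmono.measure_iUnion]
  exact iSup_le fun N => (measure_mono (Set.biInter_subset_of_mem le_rfl)).trans (h N)

lemma cayley_circleMap_one {θ : ℝ} (hθ : θ ∈ Set.Ioo 0 (2 * Real.pi)) :
    1 - circleMap 0 1 θ ≠ 0 ∧ cayley (circleMap 0 1 θ) = boundaryPoint θ := by
  set φ : ℝ := (θ - Real.pi) / 2 with hφ
  have hcos : Complex.cos φ ≠ 0 := by
    rw [← Complex.ofReal_cos, Complex.ofReal_ne_zero]
    refine (Real.cos_pos_of_mem_Ioo ⟨?_, ?_⟩).ne' <;> simp only [hφ] <;> linarith [hθ.1, hθ.2]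
  have hcs := Complex.exp_mul_I φ
  have hsc := Complex.sin_sq_add_cos_sq φ
  have hexp : circleMap 0 1 θ = -(Complex.exp (φ * Complex.I)) ^ 2 := by
    have hθφ : (θ : ℂ) * Complex.I = φ * Complex.I + φ * Complex.I + Real.pi * Complex.I := by
      simp only [hφ]
      push_cast
      ring
    rw [circleMap_zero, hθφ, Complex.exp_add, Complex.exp_add, Complex.exp_pi_mul_I]
    push_cast
    ring
  have hsum : 1 - circleMap 0 1 θ = 2 * Complex.cos φ * Complex.exp (φ * Complex.I) := by
    rw [hexp, hcs]
    linear_combination -hsc + Complex.sin φ ^ 2 * Complex.I_sq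
  have hdiff : 1 + circleMap 0 1 θ =
      -(2 * Complex.I * Complex.sin φ * Complex.exp (φ * Complex.I)) := by
    rw [hexp, hcs]
    linear_combination -hsc + Complex.sin φ ^ 2 * Complex.I_sq
  have hne : 1 - circleMap 0 1 θ ≠ 0 := by
    rw [hsum]
    exact mul_ne_zero (mul_ne_zero two_ne_zero hcos) (Complex.exp_ne_zero _)
  refine ⟨hne, ?_⟩
  have hE := Complex.exp_ne_zero (φ * Complex.I)
  rw [cayley, hsum, hdiff, boundaryPoint, ← hφ, Complex.ofReal_tan, Complex.tan_eq_sin_div_cos]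
  field_simp
  linear_combination -Complex.sin φ * Complex.I_sq

lemma tendsto_discPoint {θ : ℝ} (hθ : θ ∈ Set.Ioo 0 (2 * Real.pi)) :
    Tendsto (fun n : ℕ => discPoint (1 - 1 / ((n : ℝ) + 1)) θ) atTop
      (nhds (boundaryPoint θ : ℂ)) := by
  obtain ⟨hne, heq⟩ := cayley_circleMap_one hθ
  have h1 : Tendsto (fun n : ℕ => 1 - 1 / ((n : ℝ) + 1)) atTop (nhds 1) := by
    simpa using tendsto_one_div_add_atTop_nhds_zero_nat.const_sub (1 : ℝ)
  have h2 : Continuous fun r : ℝ => circleMap 0 r θ := by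
    unfold circleMap
    fun_prop
  rw [← heq]
  exact ((differentiableAt_cayley hne).continuousAt.tendsto.comp (h2.tendsto 1)).comp h1

lemma measurable_boundaryPoint : Measurable boundaryPoint := by
  have : boundaryPoint = fun θ => Real.sin ((θ - Real.pi) / 2) / Real.cos ((θ - Real.pi) / 2) := by
    funext θ
    exact Real.tan_eq_sin_div_cos _
  rw [this]
  fun_prop

/-- The harmonic measure on the real line seen from `i` (up to normalization). -/
noncomputable def harmonicMeasure : Measure ℝ := angleMeasure.map boundaryPoint

lemma volume_absolutelyContinuous_harmonicMeasure : volume ≪ harmonicMeasure := by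
  refine Measure.AbsolutelyContinuous.mk fun s hs h0 => ?_
  rw [harmonicMeasure, Measure.map_apply measurable_boundaryPoint hs, angleMeasure,
    Measure.restrict_apply (measurable_boundaryPoint hs)] at h0
  have hd : DifferentiableOn ℝ boundaryPoint
      (boundaryPoint ⁻¹' s ∩ Set.Ioo 0 (2 * Real.pi)) := fun θ hθ => by
    have hcos : Real.cos ((θ - Real.pi) / 2) ≠ 0 :=
      (Real.cos_pos_of_mem_Ioo ⟨by linarith [hθ.2.1], by linarith [hθ.2.2]⟩).ne'
    have h1 : DifferentiableAt ℝ (fun θ : ℝ => (θ - Real.pi) / 2) θ := by fun_prop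
    exact ((Real.differentiableAt_tan.2 hcos).comp θ h1).differentiableWithinAt
  refine measure_mono_null (fun y hy => ?_)
    (addHaar_image_eq_zero_of_differentiableOn_of_addHaar_eq_zero volume hd h0)
  have hy' : boundaryPoint (Real.pi + 2 * Real.arctan y) = y := by
    rw [boundaryPoint, add_sub_cancel_left, mul_div_cancel_left₀ _ two_ne_zero, Real.tan_arctan]
  refine ⟨Real.pi + 2 * Real.arctan y, ⟨?_, ?_, ?_⟩, hy'⟩
  · rwa [Set.mem_preimage, hy']
  · linarith [Real.neg_pi_div_two_lt_arctan y]
  · linarith [Real.arctan_lt_pi_div_two y]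

/-- The solution `u_{2,E}` of the eigenvalue equation with `u(0) = 1`, `u(1) = 0`. -/
noncomputable def u2sol (a b : ℕ → ℝ) (E : ℝ) : ℕ → ℝ
  | 0 => 1
  | 1 => 0
  | (j + 2) => ((E - b (j + 1)) * u2sol a b E (j + 1) - a j * u2sol a b E j) / a (j + 1)

/-- The solution of the eigenvalue equation at the complex energy `z` with initial values
`u(0) = c₀`, `u(1) = c₁`. -/
noncomputable def complexSol (a b : ℕ → ℝ) (c₀ c₁ : ℂ) (z : ℂ) : ℕ → ℂ
  | 0 => c₀
  | 1 => c₁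
  | (j + 2) => ((z - b (j + 1)) * complexSol a b c₀ c₁ z (j + 1)
      - a j * complexSol a b c₀ c₁ z j) / a (j + 1)

section Solutions

variable (a b : ℕ → ℝ)

lemma complexSol_ofReal_u1sol (E : ℝ) (j : ℕ) : complexSol a b 0 1 E j = u1sol a b E j := by
  induction j using Nat.twoStepInduction with
  | zero => simp [complexSol, u1sol]
  | one => simp [complexSol, u1sol]
  | more j ih0 ih1 => simp [complexSol, u1sol, ih0, ih1]

lemma complexSol_ofReal_u2sol (E : ℝ) (j : ℕ) : complexSol a b 1 0 E j = u2sol a b E j := by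
  induction j using Nat.twoStepInduction with
  | zero => simp [complexSol, u2sol]
  | one => simp [complexSol, u2sol]
  | more j ih0 ih1 => simp [complexSol, u2sol, ih0, ih1]

lemma continuous_complexSol (c₀ c₁ : ℂ) (j : ℕ) :
    Continuous fun z => complexSol a b c₀ c₁ z j := by
  induction j using Nat.twoStepInduction with
  | zero => simpa [complexSol] using continuous_const
  | one => simpa [complexSol] using continuous_const
  | more j ih0 ih1 =>
    simp only [complexSol]
    fun_prop

lemma continuous_u1sol (j : ℕ) : Continuous fun E => u1sol a b E j := by
  have := Complex.continuous_re.comp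
    ((continuous_complexSol a b 0 1 j).comp Complex.continuous_ofReal)
  simpa [Function.comp_def, complexSol_ofReal_u1sol] using this

lemma continuous_u2sol (j : ℕ) : Continuous fun E => u2sol a b E j := by
  have := Complex.continuous_re.comp
    ((continuous_complexSol a b 1 0 j).comp Complex.continuous_ofReal)
  simpa [Function.comp_def, complexSol_ofReal_u2sol] using this

variable {a b}

lemma stieltjes_u1sol_recurrence (hapos : ∀ j, 1 ≤ j → 0 < a j) {μ : Measure ℝ}
    (hint : ∀ j, Integrable (fun E => u1sol a b E j) μ) {z : ℂ} (hz : 0 < z.im) (j : ℕ) :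
    stieltjes μ (fun E => u1sol a b E (j + 2)) z =
      (((∫ E, u1sol a b E (j + 1) ∂μ : ℝ) : ℂ)
        + (z - b (j + 1)) * stieltjes μ (fun E => u1sol a b E (j + 1)) z
        - a j * stieltjes μ (fun E => u1sol a b E j) z) / a (j + 1) := by
  have ha : (a (j + 1) : ℂ) ≠ 0 := Complex.ofReal_ne_zero.2 (hapos _ (by omega)).ne'
  have h0 := integrable_stieltjes_kernel (hint j) hz
  have h1 := integrable_stieltjes_kernel (hint (j + 1)) hz
  have hp : Integrable (fun E => (u1sol a b E (j + 1) : ℂ)) μ := (hint (j + 1)).ofReal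
  have hker : ∀ x : ℝ, (u1sol a b x (j + 2) : ℂ) / (x - z) =
      ((u1sol a b x (j + 1) : ℂ) + (z - b (j + 1)) * ((u1sol a b x (j + 1) : ℂ) / (x - z))
        - a j * ((u1sol a b x j : ℂ) / (x - z))) / a (j + 1) := fun x => by
    have hx := ofReal_sub_ne_zero x hz
    simp only [u1sol]
    push_cast
    field_simp
    ring
  have hadd : Integrable (fun x : ℝ => (u1sol a b x (j + 1) : ℂ)
      + (z - b (j + 1)) * ((u1sol a b x (j + 1) : ℂ) / (x - z))) μ := hp.add (h1.const_mul _)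
  unfold stieltjes
  simp only [hker]
  rw [integral_div, integral_sub hadd (h0.const_mul _),
    integral_add hp (h1.const_mul _), integral_const_mul, integral_const_mul]
  congr 4
  exact integral_ofReal

lemma complexSol_eq_stieltjes (ha0 : a 0 = 1) (hapos : ∀ j, 1 ≤ j → 0 < a j) {μ : Measure ℝ}
    (hint : ∀ j, Integrable (fun E => u1sol a b E j) μ)
    (hmean : ∀ j, ∫ E, u1sol a b E (j + 1) ∂μ = if j = 0 then 1 else 0)
    {z : ℂ} (hz : 0 < z.im) (j : ℕ) :
    complexSol a b 1 0 z (j + 1) =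
      complexSol a b 0 1 z (j + 1) * stieltjes μ (fun E => u1sol a b E 1) z
        - stieltjes μ (fun E => u1sol a b E (j + 1)) z := by
  have hzero : stieltjes μ (fun E => u1sol a b E 0) z = 0 := by simp [stieltjes, u1sol]
  induction j using Nat.twoStepInduction with
  | zero => simp [complexSol]
  | one =>
    rw [stieltjes_u1sol_recurrence hapos hint hz 0, hmean 0, hzero]
    simp only [complexSol, ha0]
    push_cast
    ring
  | more j ih0 ih1 =>
    rw [stieltjes_u1sol_recurrence hapos hint hz (j + 1), hmean (j + 1)]
    rw [complexSol, ih0, ih1, complexSol.eq_3 a b 0 1 z (j + 1)]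
    simp only [Nat.succ_ne_zero, if_false]
    push_cast
    ring

/-- Where the orthonormal polynomial `u_{1,E}(j)` is bounded by `M`, the second solution is
of weak type `L¹` for harmonic measure, uniformly in `j`. -/
lemma harmonicMeasure_u2sol_gt_le (ha0 : a 0 = 1) (hapos : ∀ j, 1 ≤ j → 0 < a j)
    {μ : Measure ℝ} (hint : ∀ j, Integrable (fun E => u1sol a b E j) μ)
    (habs : ∀ j, ∫ E, |u1sol a b E j| ∂μ ≤ 1)
    (hmean : ∀ j, ∫ E, u1sol a b E (j + 1) ∂μ = if j = 0 then 1 else 0)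
    {M L : ℝ} (hM : 0 < M) (hL : 0 < L) (j : ℕ) :
    harmonicMeasure {E | L < |u2sol a b E (j + 1)| ∧ |u1sol a b E (j + 1)| < M} ≤
      ENNReal.ofReal (32 * Real.pi * (M + 1) / L) := by
  have hmeas : MeasurableSet {E | L < |u2sol a b E (j + 1)| ∧ |u1sol a b E (j + 1)| < M} :=
    (measurableSet_lt measurable_const (continuous_u2sol a b (j + 1)).measurable.abs).inter
      (measurableSet_lt (continuous_u1sol a b (j + 1)).measurable.abs measurable_const)
  rw [harmonicMeasure, Measure.map_apply measurable_boundaryPoint hmeas]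
  set r : ℕ → ℝ := fun n => 1 - 1 / ((n : ℝ) + 1) with hr
  have hr0 : ∀ n, 0 ≤ r n := fun n => by
    have : 1 / ((n : ℝ) + 1) ≤ 1 := by
      rw [div_le_one (by positivity)]
      linarith [n.cast_nonneg (α := ℝ)]
    simp only [hr]
    linarith
  have hr1 : ∀ n, r n < 1 := fun n => by
    have : 0 < 1 / ((n : ℝ) + 1) := by positivity
    simp only [hr]
    linarith
  set s : ℕ → Set ℝ := fun n => {θ | L < ‖complexSol a b 1 0 (discPoint (r n) θ) (j + 1)‖ ∧
    ‖complexSol a b 0 1 (discPoint (r n) θ) (j + 1)‖ < M} with hs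
  have hsub : (boundaryPoint ⁻¹' {E | L < |u2sol a b E (j + 1)| ∧ |u1sol a b E (j + 1)| < M}
      : Set ℝ) ≤ᵐ[angleMeasure] {θ | ∀ᶠ n in atTop, θ ∈ s n} := by
    filter_upwards [ae_restrict_mem measurableSet_Ioo] with θ hθ hE
    have hlim := tendsto_discPoint hθ
    have h2 := (((continuous_complexSol a b 1 0 (j + 1)).tendsto _).comp hlim).norm
    have h1 := (((continuous_complexSol a b 0 1 (j + 1)).tendsto _).comp hlim).norm
    rw [complexSol_ofReal_u2sol, Complex.norm_real] at h2
    rw [complexSol_ofReal_u1sol, Complex.norm_real] at h1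
    exact (h2.eventually_const_lt hE.1).and (h1.eventually_lt_const hE.2)
  refine (measure_mono_ae hsub).trans (measure_eventually_mem_le fun n => ?_)
  have hincl : s n ⊆
      {θ | L / (2 * M) ≤ ‖stieltjes μ (fun E => u1sol a b E 1) (discPoint (r n) θ)‖} ∪
      {θ | L / 2 ≤ ‖stieltjes μ (fun E => u1sol a b E (j + 1)) (discPoint (r n) θ)‖} := by
    intro θ hθ
    have heq := complexSol_eq_stieltjes ha0 hapos hint hmean
      (discPoint_im_pos (hr0 n) (hr1 n) θ) j
    have h3 := (congrArg norm heq).le.trans (norm_sub_le _ _)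
    rw [norm_mul] at h3
    by_contra hcon
    simp only [Set.mem_union, Set.mem_ofPred_eq, not_or, not_le] at hcon
    have h4 := mul_le_mul hθ.2.le hcon.1.le (norm_nonneg _) hM.le
    have h5 : M * (L / (2 * M)) = L / 2 := by field_simp
    linarith [hθ.1, hcon.2]
  have hF := angleMeasure_stieltjes_signed_ge_le (hint 1) (hr0 n) (hr1 n)
    (c := L / (2 * M)) (by positivity)
  have hG := angleMeasure_stieltjes_signed_ge_le (hint (j + 1)) (hr0 n) (hr1 n)
    (c := L / 2) (by positivity)
  refine (measure_mono hincl).trans ((measure_union_le _ _).trans ((add_le_add hF hG).trans ?_))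
  have hn : ∀ i, 0 ≤ ∫ E, |u1sol a b E i| ∂μ := fun i => integral_nonneg fun E => abs_nonneg _
  have hn1 := hn 1
  have hnj := hn (j + 1)
  rw [← ENNReal.ofReal_add (by positivity) (by positivity)]
  refine ENNReal.ofReal_le_ofReal ?_
  calc 16 * Real.pi * (∫ E, |u1sol a b E 1| ∂μ) / (L / (2 * M))
        + 16 * Real.pi * (∫ E, |u1sol a b E (j + 1)| ∂μ) / (L / 2)
      ≤ 16 * Real.pi * 1 / (L / (2 * M)) + 16 * Real.pi * 1 / (L / 2) := by
        gcongr
        · exact habs 1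
        · exact habs (j + 1)
    _ = 32 * Real.pi * (M + 1) / L := by
        field_simp
        ring

lemma measure_abs_ge_le {μ : Measure ℝ} {f : ℝ → ℝ} (hf : Integrable (fun x => f x ^ 2) μ)
    [IsFiniteMeasure μ] (h1 : ∫ x, f x ^ 2 ∂μ ≤ 1) {M : ℝ} (hM : 0 < M) :
    μ {x | M ≤ |f x|} ≤ ENNReal.ofReal (1 / M ^ 2) := by
  have hmk := mul_meas_ge_le_integral_of_nonneg (ae_of_all μ fun x => sq_nonneg (f x)) hf (M ^ 2)
  have hset : {x | M ≤ |f x|} ⊆ {x | M ^ 2 ≤ f x ^ 2} := fun x hx => by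
    have hx' : M ≤ |f x| := hx
    rw [Set.mem_ofPred_eq, ← sq_abs (f x)]
    gcongr
  refine (measure_mono hset).trans ?_
  rw [← ofReal_measureReal]
  refine ENNReal.ofReal_le_ofReal ?_
  rw [le_div_iff₀ (by positivity), mul_comm]
  exact hmk.trans h1

lemma Tmat_eq (ha0 : a 0 = 1) (hapos : ∀ j, 1 ≤ j → 0 < a j) (E : ℝ) (j : ℕ) :
    Tmat a b E j = !![u1sol a b E (j + 1), u2sol a b E (j + 1); u1sol a b E j, u2sol a b E j] ∧
      (Tmat a b E j).det = 1 / a j := by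
  induction j with
  | zero =>
    refine ⟨?_, by simp [Tmat, ha0]⟩
    ext i k
    fin_cases i <;> fin_cases k <;> simp [Tmat, u1sol, u2sol]
  | succ j ih =>
    have hj1 : a (j + 1) ≠ 0 := (hapos _ (by omega)).ne'
    have hj : a j ≠ 0 := by
      rcases Nat.eq_zero_or_pos j with rfl | h
      · simp [ha0]
      · exact (hapos _ h).ne'
    refine ⟨?_, ?_⟩
    · rw [Tmat, ih.1, Smat, Matrix.mul_fin_two]
      simp only [Nat.add_sub_cancel, u1sol, u2sol]
      ext i k
      fin_cases i <;> fin_cases k <;> simp <;> field_simp <;> ring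
    · rw [Tmat, Matrix.det_mul, ih.2, Smat, Matrix.det_fin_two_of]
      simp only [Nat.add_sub_cancel]
      field_simp
      ring

end Solutions

lemma matOpNorm_le_sum (M : Matrix (Fin 2) (Fin 2) ℝ) :
    matOpNorm M ≤ |M 0 0| + |M 0 1| + |M 1 0| + |M 1 1| := by
  have hle : ∀ x y A B : ℝ, 0 ≤ A → 0 ≤ B → |x| ≤ A → |y| ≤ B → √(x ^ 2 + y ^ 2) ≤ A + B := by
    intro x y A B hA hB hx hy
    refine Real.sqrt_le_iff.2 ⟨by positivity, ?_⟩
    nlinarith [sq_le_sq' (abs_le.1 hx).1 (abs_le.1 hx).2, sq_le_sq' (abs_le.1 hy).1 (abs_le.1 hy).2,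
      mul_nonneg hA hB]
  refine ContinuousLinearMap.opNorm_le_bound _ (by positivity) fun v => ?_
  have hv : ∀ i, |v i| ≤ ‖v‖ := fun i => PiLp.norm_apply_le v i
  have hrow : ∀ i, |M i 0 * v 0 + M i 1 * v 1| ≤ (|M i 0| + |M i 1|) * ‖v‖ := fun i => by
    refine (abs_add_le _ _).trans ?_
    rw [abs_mul, abs_mul, add_mul]
    gcongr <;> exact hv _
  have := hle _ _ _ _ (by positivity) (by positivity) (hrow 0) (hrow 1)
  rw [EuclideanSpace.norm_eq]
  simp only [Matrix.ofLp_toEuclideanCLM, Matrix.mulVec, dotProduct, Fin.sum_univ_two,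
    Real.norm_eq_abs, sq_abs]
  linarith

lemma transfer_ratio_le {a b : ℕ → ℝ} (ha0 : a 0 = 1) (hapos : ∀ j, 1 ≤ j → 0 < a j) {E K : ℝ}
    (m l : ℕ) (hm1 : |u1sol a b E (m + 1)| ≤ K) (hm2 : |u2sol a b E (m + 1)| ≤ K)
    (hm3 : |u1sol a b E m| ≤ K) (hm4 : |u2sol a b E m| ≤ K)
    (hl1 : |u1sol a b E (l + 1)| ≤ K) (hl2 : |u2sol a b E (l + 1)| ≤ K)
    (hl3 : |u1sol a b E l| ≤ K) (hl4 : |u2sol a b E l| ≤ K) :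
    1 / a l * matOpNorm (Tmat a b E m * (Tmat a b E l)⁻¹) ≤ 8 * K ^ 2 := by
  have hal : 0 < a l := by
    rcases Nat.eq_zero_or_pos l with rfl | h
    · simp [ha0]
    · exact hapos _ h
  have hinv : (Tmat a b E l)⁻¹ = a l • (Tmat a b E l).adjugate := by
    rw [Matrix.inv_def, (Tmat_eq ha0 hapos E l).2, Ring.inverse_eq_inv', one_div, inv_inv]
  have hsmul : ∀ N, matOpNorm (a l • N) = a l * matOpNorm N := fun N => by
    rw [matOpNorm, map_smul, norm_smul, Real.norm_of_nonneg hal.le, matOpNorm]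
  rw [hinv, Matrix.mul_smul, hsmul, ← mul_assoc, one_div_mul_cancel hal.ne', one_mul]
  refine (matOpNorm_le_sum _).trans ?_
  rw [(Tmat_eq ha0 hapos E l).1, (Tmat_eq ha0 hapos E m).1, Matrix.adjugate_fin_two_of,
    Matrix.mul_fin_two]
  have key : ∀ x y z w : ℝ, |x| ≤ K → |y| ≤ K → |z| ≤ K → |w| ≤ K →
      |x * y + z * w| ≤ 2 * K ^ 2 := by
    intro x y z w hx hy hz hw
    have hK : 0 ≤ K := (abs_nonneg _).trans hx
    have h1 := mul_le_mul hx hy (abs_nonneg _) hK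
    have h2 := mul_le_mul hz hw (abs_nonneg _) hK
    rw [← abs_mul] at h1 h2
    linarith [abs_add_le (x * y) (z * w)]
  have e1 := key _ _ _ (-u1sol a b E l) hm1 hl4 hm2 (by rwa [abs_neg])
  have e2 := key _ (-u2sol a b E (l + 1)) _ _ hm1 (by rwa [abs_neg]) hm2 hl1
  have e3 := key _ _ _ (-u1sol a b E l) hm3 hl4 hm4 (by rwa [abs_neg])
  have e4 := key _ (-u2sol a b E (l + 1)) _ _ hm3 (by rwa [abs_neg]) hm4 hl1
  simp only [Matrix.of_apply, Matrix.cons_val', Matrix.cons_val_zero, Matrix.cons_val_one,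
    Matrix.cons_val_fin_one]
  linarith

section Tightness

variable {a b : ℕ → ℝ} {μ ρ : Measure ℝ}

/-- The uniform tail bound, at height `M ^ 2`, for both solutions of the eigenvalue equation with
respect to a measure dominated by `μ` and by harmonic measure. -/
noncomputable def tailBound (M : ℝ) : ENNReal :=
  ENNReal.ofReal (1 / M ^ 2) + ENNReal.ofReal (32 * Real.pi * (M + 1) / M ^ 2)

lemma tendsto_tailBound : Tendsto (fun n : ℕ => tailBound ((n : ℝ) + 1)) atTop (nhds 0) := by
  have h1 : Tendsto (fun n : ℕ => 1 / ((n : ℝ) + 1)) atTop (nhds 0) :=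
    tendsto_one_div_add_atTop_nhds_zero_nat
  have h2 : Tendsto (fun n : ℕ => 1 / ((n : ℝ) + 1) ^ 2) atTop (nhds 0) := by
    simpa [one_div, inv_pow] using h1.pow 2
  have h3 : Tendsto (fun n : ℕ => 32 * Real.pi * ((n : ℝ) + 1 + 1) / ((n : ℝ) + 1) ^ 2) atTop
      (nhds 0) := by
    have h4 := ((h1.add h2).const_mul (32 * Real.pi))
    rw [add_zero, mul_zero] at h4
    refine h4.congr fun n => ?_
    have : (n : ℝ) + 1 ≠ 0 := by positivity
    field_simp
  simpa [tailBound] using (ENNReal.tendsto_ofReal h2).add (ENNReal.tendsto_ofReal h3)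

lemma integrable_u1sol_sq
    (horth : ∀ i j : ℕ, 1 ≤ i → 1 ≤ j →
      ∫ E, u1sol a b E i * u1sol a b E j ∂μ = if i = j then 1 else 0)
    (j : ℕ) :
    Integrable (fun E => u1sol a b E j ^ 2) μ ∧ ∫ E, u1sol a b E j ^ 2 ∂μ ≤ 1 := by
  rcases Nat.eq_zero_or_pos j with rfl | hj
  · simp [u1sol]
  · have h := horth j j hj hj
    simp only [← sq, if_true] at h
    refine ⟨?_, h.le⟩
    by_contra hcon
    rw [integral_undef hcon] at h
    exact zero_ne_one h

lemma integral_u1sol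
    (horth : ∀ i j : ℕ, 1 ≤ i → 1 ≤ j →
      ∫ E, u1sol a b E i * u1sol a b E j ∂μ = if i = j then 1 else 0)
    (j : ℕ) : ∫ E, u1sol a b E (j + 1) ∂μ = if j = 0 then 1 else 0 := by
  simpa [u1sol] using horth (j + 1) 1 (by omega) le_rfl

variable [IsFiniteMeasure μ]

lemma integrable_u1sol
    (horth : ∀ i j : ℕ, 1 ≤ i → 1 ≤ j →
      ∫ E, u1sol a b E i * u1sol a b E j ∂μ = if i = j then 1 else 0)
    (j : ℕ) : Integrable (fun E => u1sol a b E j) μ := by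
  refine ((integrable_u1sol_sq horth j).1.add (integrable_const 1)).mono'
    (continuous_u1sol a b j).aestronglyMeasurable (ae_of_all _ fun E => ?_)
  simp only [Pi.add_apply, Real.norm_eq_abs]
  nlinarith [sq_abs (u1sol a b E j), sq_nonneg (|u1sol a b E j| - 1)]

lemma integral_abs_u1sol_le
    (horth : ∀ i j : ℕ, 1 ≤ i → 1 ≤ j →
      ∫ E, u1sol a b E i * u1sol a b E j ∂μ = if i = j then 1 else 0)
    (j : ℕ) : ∫ E, |u1sol a b E j| ∂μ ≤ 1 := by
  obtain ⟨hi, h1⟩ := integrable_u1sol_sq horth j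
  have hone : ∫ _, (1 : ℝ) ∂μ = 1 := by simpa [u1sol] using horth 1 1 le_rfl le_rfl
  have hle : ∫ E, |u1sol a b E j| ∂μ ≤ ∫ E, (u1sol a b E j ^ 2 + 1) / 2 ∂μ := by
    refine integral_mono (integrable_u1sol horth j).abs
      ((hi.add (integrable_const 1)).div_const 2) fun E => ?_
    simp only
    nlinarith [sq_abs (u1sol a b E j), sq_nonneg (|u1sol a b E j| - 1)]
  rw [integral_div, integral_add hi (integrable_const 1), hone] at hle
  linarith

lemma measure_u1sol_gt_le
    (horth : ∀ i j : ℕ, 1 ≤ i → 1 ≤ j →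
      ∫ E, u1sol a b E i * u1sol a b E j ∂μ = if i = j then 1 else 0)
    (hρμ : ρ ≤ μ) {M : ℝ} (hM : 1 ≤ M) (j : ℕ) :
    ρ {E | M ^ 2 < |u1sol a b E j|} ≤ tailBound M := by
  obtain ⟨hi, h1⟩ := integrable_u1sol_sq horth j
  have hsub : {E | M ^ 2 < |u1sol a b E j|} ⊆ {E | M ≤ |u1sol a b E j|} := fun E hE => by
    have hE' : M ^ 2 < |u1sol a b E j| := hE
    rw [Set.mem_ofPred_eq]
    nlinarith
  exact (measure_mono hsub).trans ((hρμ _).trans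
    ((measure_abs_ge_le hi h1 (by linarith)).trans le_self_add))

lemma measure_u2sol_gt_le
    (horth : ∀ i j : ℕ, 1 ≤ i → 1 ≤ j →
      ∫ E, u1sol a b E i * u1sol a b E j ∂μ = if i = j then 1 else 0)
    (ha0 : a 0 = 1) (hapos : ∀ j, 1 ≤ j → 0 < a j) (hρμ : ρ ≤ μ)
    (hρ : ρ ≤ harmonicMeasure) {M : ℝ} (hM : 1 ≤ M) (j : ℕ) :
    ρ {E | M ^ 2 < |u2sol a b E j|} ≤ tailBound M := by
  have hM0 : 0 < M := by linarith
  rcases j with _ | j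
  · have : {E | M ^ 2 < |u2sol a b E 0|} = ∅ := by
      ext E
      simp only [u2sol, abs_one, Set.mem_ofPred_eq, Set.mem_empty_iff_false, iff_false, not_lt]
      nlinarith
    simp [this]
  · obtain ⟨hi, h1⟩ := integrable_u1sol_sq horth (j + 1)
    have hsub : {E | M ^ 2 < |u2sol a b E (j + 1)|} ⊆ {E | M ≤ |u1sol a b E (j + 1)|} ∪
        {E | M ^ 2 < |u2sol a b E (j + 1)| ∧ |u1sol a b E (j + 1)| < M} := fun E hE =>
      (le_or_gt M |u1sol a b E (j + 1)|).imp id fun h => ⟨hE, h⟩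
    refine (measure_mono hsub).trans ((measure_union_le _ _).trans (add_le_add ?_ ?_))
    · exact (hρμ _).trans (measure_abs_ge_le hi h1 hM0)
    · exact (hρ _).trans (harmonicMeasure_u2sol_gt_le ha0 hapos (integrable_u1sol horth)
        (integral_abs_u1sol_le horth) (integral_u1sol horth) hM0 (by positivity) j)

end Tightness

/-- The energies at which some entry of the transfer matrix `T_j(E)` exceeds `K` in absolute
value. -/
def largeTransferSet (a b : ℕ → ℝ) (K : ℝ) (j : ℕ) : Set ℝ :=
  ({E | K < |u1sol a b E (j + 1)|} ∪ {E | K < |u2sol a b E (j + 1)|}) ∪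
    ({E | K < |u1sol a b E j|} ∪ {E | K < |u2sol a b E j|})

lemma measurableSet_largeTransferSet (a b : ℕ → ℝ) (K : ℝ) (j : ℕ) :
    MeasurableSet (largeTransferSet a b K j) := by
  have h1 : ∀ i, MeasurableSet {E | K < |u1sol a b E i|} := fun i =>
    measurableSet_lt measurable_const (continuous_u1sol a b i).measurable.abs
  have h2 : ∀ i, MeasurableSet {E | K < |u2sol a b E i|} := fun i =>
    measurableSet_lt measurable_const (continuous_u2sol a b i).measurable.abs
  exact ((h1 _).union (h2 _)).union ((h1 _).union (h2 _))

lemma measure_largeTransferSet_le {a b : ℕ → ℝ} {μ ρ : Measure ℝ} [IsFiniteMeasure μ]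
    (ha0 : a 0 = 1) (hapos : ∀ j, 1 ≤ j → 0 < a j)
    (horth : ∀ i j : ℕ, 1 ≤ i → 1 ≤ j →
      ∫ E, u1sol a b E i * u1sol a b E j ∂μ = if i = j then 1 else 0)
    (hρμ : ρ ≤ μ) (hρ : ρ ≤ harmonicMeasure) {M : ℝ} (hM : 1 ≤ M) (j : ℕ) :
    ρ (largeTransferSet a b (M ^ 2) j) ≤ 4 * tailBound M := by
  have h1 := measure_u1sol_gt_le horth hρμ hM
  have h2 := measure_u2sol_gt_le horth ha0 hapos hρμ hρ hM
  calc ρ (largeTransferSet a b (M ^ 2) j)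
      ≤ (tailBound M + tailBound M) + (tailBound M + tailBound M) :=
        (measure_union_le _ _).trans (add_le_add
          ((measure_union_le _ _).trans (add_le_add (h1 _) (h2 _)))
          ((measure_union_le _ _).trans (add_le_add (h1 _) (h2 _))))
    _ = 4 * tailBound M := by ring

/-- Proposition B.5 of Breuer, after Last–Simon: the set
`A₁ = {E : liminf_j (1/a(l_j)) ‖T_{m_j}(E) T_{l_j}(E)⁻¹‖ < ∞}` supports the absolutely
continuous part of the measure of orthonormality `μ` of the polynomials `u_{1,E}(j)`:
the restriction of `μ` to `ℝ ∖ A₁` is singular with respect to Lebesgue measure. -/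
theorem ac_part_supported_on_bounded_transfer_set
    (a b : ℕ → ℝ) (ha0 : a 0 = 1) (hapos : ∀ j, 1 ≤ j → 0 < a j)
    (hdiv : ¬ Summable fun j : ℕ => 1 / a (j + 1))
    (m l : ℕ → ℕ)
    (A₁ : Set ℝ)
    (hA₁ : A₁ = {E : ℝ | ∃ C : ℝ, ∃ᶠ j in atTop,
      (1 / a (l j)) * matOpNorm (Tmat a b E (m j) * (Tmat a b E (l j))⁻¹) ≤ C})
    (μ : Measure ℝ) [IsFiniteMeasure μ]
    (horth : ∀ i j : ℕ, 1 ≤ i → 1 ≤ j →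
      ∫ E, u1sol a b E i * u1sol a b E j ∂μ = if i = j then 1 else 0) :
    μ.restrict A₁ᶜ ⟂ₘ volume := by
  set B : ℕ → Set ℝ := fun n => {E | ∀ᶠ j in atTop,
    E ∈ largeTransferSet a b (((n : ℝ) + 1) ^ 2) (m j) ∪
      largeTransferSet a b (((n : ℝ) + 1) ^ 2) (l j)} with hB
  have hBmeas : MeasurableSet (⋂ n, B n) := by
    refine MeasurableSet.iInter fun n => ?_
    have : B n = ⋃ N, ⋂ j ≥ N, (largeTransferSet a b (((n : ℝ) + 1) ^ 2) (m j) ∪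
        largeTransferSet a b (((n : ℝ) + 1) ^ 2) (l j)) := by
      ext E
      simp [hB, eventually_atTop]
    rw [this]
    exact MeasurableSet.iUnion fun N => MeasurableSet.iInter fun j => MeasurableSet.iInter fun _ =>
      (measurableSet_largeTransferSet a b _ _).union (measurableSet_largeTransferSet a b _ _)
  have hsub : A₁ᶜ ⊆ ⋂ n, B n := by
    intro E hE
    refine Set.mem_iInter.2 fun n => ?_
    by_contra hcon
    refine hE ?_
    rw [hA₁]
    refine ⟨8 * (((n : ℝ) + 1) ^ 2) ^ 2, (not_eventually.1 hcon).mono fun j hj => ?_⟩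
    simp only [largeTransferSet, Set.mem_union, Set.mem_ofPred_eq, not_or, not_lt] at hj
    obtain ⟨⟨⟨h1, h2⟩, h3, h4⟩, ⟨h5, h6⟩, h7, h8⟩ := hj
    exact transfer_ratio_le ha0 hapos (m j) (l j) h1 h2 h3 h4 h5 h6 h7 h8
  have hsing : μ.restrict (⋂ n, B n) ⟂ₘ harmonicMeasure := by
    refine Measure.mutuallySingular_of_disjoint (disjoint_iff_inf_le.2 ?_)
    set ρ := μ.restrict (⋂ n, B n) ⊓ harmonicMeasure
    have hρr : ρ ≤ μ.restrict (⋂ n, B n) := inf_le_left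
    have hρμ : ρ ≤ μ := hρr.trans Measure.restrict_le_self
    have hρh : ρ ≤ harmonicMeasure := inf_le_right
    have hcompl : ρ (⋂ n, B n)ᶜ = 0 := by
      refine le_antisymm ((hρr _).trans ?_) zero_le
      rw [Measure.restrict_apply hBmeas.compl]
      rw [Set.compl_inter_self, measure_empty]
    have hmem : ρ (⋂ n, B n) = 0 := by
      have hbound : ∀ n : ℕ, ρ (⋂ n, B n) ≤ 8 * tailBound ((n : ℝ) + 1) := fun n => by
        refine (measure_mono (Set.iInter_subset B n)).trans (measure_eventually_mem_le fun j => ?_)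
        have hn : (1 : ℝ) ≤ (n : ℝ) + 1 := by linarith [n.cast_nonneg (α := ℝ)]
        have h := measure_largeTransferSet_le ha0 hapos horth hρμ hρh hn
        refine (measure_union_le _ _).trans ((add_le_add (h _) (h _)).trans (le_of_eq ?_))
        ring
      have hlim := ENNReal.Tendsto.const_mul (a := 8) tendsto_tailBound (Or.inr (by simp))
      rw [mul_zero] at hlim
      exact le_antisymm (ge_of_tendsto' hlim hbound) zero_le
    refine (Measure.measure_univ_eq_zero.1 ?_).le
    rw [← Set.union_compl_self (⋂ n, B n)]
    exact measure_union_null hmem hcompl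
  exact (hsing.mono (Measure.restrict_mono hsub le_rfl) le_rfl).mono_ac
    Measure.AbsolutelyContinuous.rfl volume_absolutelyContinuous_harmonicMeasure
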